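/- Under the SVARM model with K ≥ 1 main-loop pairs and T̄ = 2K, for any fixed player i ∈ N and any ε > 0, P(|φ̂_i − φ_i| ≥ ε) ≤ (2Hₙ / (ε²·T̄))·(σ_i⁻² + σ_i⁺²) (Theorem 4.4). -/

import Mathlib

open Finset
open scoped Classical

noncomputable section

/-- The `n`-th harmonic number `Hₙ = ∑_{k=1}^n 1/k`. -/
def harm (n : ℕ) : ℝ := ∑ k ∈ Finset.range n, (1 : ℝ) / (k + 1)

/-- The player set `N_i = N \ {i}`. -/
def Ni (n : ℕ) (i : Fin n) : Finset (Fin n) := Finset.univ.erase i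

/-- The Shapley weights `w_S = 1/(n·C(n−1,|S|))` (defining `P^w` on subsets of `N_i`). -/
def wgt (n : ℕ) (S : Finset (Fin n)) : ℝ :=
  1 / ((n : ℝ) * (Nat.choose (n - 1) S.card : ℝ))

/-- The SVARM sampling distribution `P⁺(S) = 1/(|S|·C(n,|S|)·Hₙ)` on nonempty `S ⊆ N`
(the formula evaluates to `0` on `S = ∅` by division-by-zero conventions). -/
def Pplus (n : ℕ) (S : Finset (Fin n)) : ℝ :=
  1 / ((S.card : ℝ) * (Nat.choose n S.card : ℝ) * harm n)

/-- The SVARM sampling distribution `P⁻(S) = 1/((n−|S|)·C(n,|S|)·Hₙ)` on proper `S ⊊ N`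
(the formula evaluates to `0` on `S = N` by division-by-zero conventions). -/
def Pminus (n : ℕ) (S : Finset (Fin n)) : ℝ :=
  1 / (((n : ℝ) - (S.card : ℝ)) * (Nat.choose n S.card : ℝ) * harm n)

/-- Sample space of SVARM with `K` main-loop pairs: warm-up samples `B⁺, B⁻` and main
samples `A₁⁺,…,A_K⁺`, `A₁⁻,…,A_K⁻`. -/
abbrev Omega (n K : ℕ) :=
  Finset (Fin n) × Finset (Fin n) × (Fin K → Finset (Fin n)) × (Fin K → Finset (Fin n))

/-- Joint pmf of the mutually independent samples `B⁺, B⁻ ∼ P^w` (subsets of `N_i`),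
`A₁⁺,…,A_K⁺` i.i.d. `∼ P⁺` and `A₁⁻,…,A_K⁻` i.i.d. `∼ P⁻`. -/
def jointP (n K : ℕ) (i : Fin n) (ω : Omega n K) : ℝ :=
  (if ω.1 ⊆ Ni n i then wgt n ω.1 else 0) *
    (if ω.2.1 ⊆ Ni n i then wgt n ω.2.1 else 0) *
    (∏ k, Pplus n (ω.2.2.1 k)) * (∏ k, Pminus n (ω.2.2.2 k))

/-- Expectation with respect to the joint distribution of the SVARM samples. -/
def expVal (n K : ℕ) (i : Fin n) (f : Omega n K → ℝ) : ℝ :=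
  ∑ ω : Omega n K, jointP n K i ω * f ω

/-- Probability of an event under the joint distribution of the SVARM samples. -/
def probEvent (n K : ℕ) (i : Fin n) (E : Omega n K → Prop) : ℝ :=
  ∑ ω : Omega n K, if E ω then jointP n K i ω else 0

/-- The sample count `m_i⁺ = 1 + #{k : i ∈ A_k⁺}`. -/
def mplus (n K : ℕ) (i : Fin n) (ω : Omega n K) : ℕ :=
  1 + (Finset.univ.filter fun k => i ∈ ω.2.2.1 k).card

/-- The sample count `m_i⁻ = 1 + #{k : i ∉ A_k⁻}`. -/
def mminus (n K : ℕ) (i : Fin n) (ω : Omega n K) : ℕ :=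
  1 + (Finset.univ.filter fun k => i ∉ ω.2.2.2 k).card

/-- The estimate `φ̂_i⁺ = (ν(B⁺ ∪ {i}) + ∑_{k : i ∈ A_k⁺} ν(A_k⁺))/m_i⁺`. -/
def phiHatPlus (n K : ℕ) (ν : Finset (Fin n) → ℝ) (i : Fin n) (ω : Omega n K) : ℝ :=
  (ν (insert i ω.1) + ∑ k ∈ Finset.univ.filter (fun k => i ∈ ω.2.2.1 k), ν (ω.2.2.1 k)) /
    (mplus n K i ω : ℝ)

/-- The estimate `φ̂_i⁻ = (ν(B⁻) + ∑_{k : i ∉ A_k⁻} ν(A_k⁻))/m_i⁻`. -/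
def phiHatMinus (n K : ℕ) (ν : Finset (Fin n) → ℝ) (i : Fin n) (ω : Omega n K) : ℝ :=
  (ν ω.2.1 + ∑ k ∈ Finset.univ.filter (fun k => i ∉ ω.2.2.2 k), ν (ω.2.2.2 k)) /
    (mminus n K i ω : ℝ)

/-- The SVARM estimator `φ̂_i = φ̂_i⁺ − φ̂_i⁻`. -/
def phiHat (n K : ℕ) (ν : Finset (Fin n) → ℝ) (i : Fin n) (ω : Omega n K) : ℝ :=
  phiHatPlus n K ν i ω - phiHatMinus n K ν i ω

/-- The Shapley value `φ_i = ∑_{S ⊆ N_i} w_S (ν(S∪{i}) − ν(S))`. -/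
def shapley (n : ℕ) (ν : Finset (Fin n) → ℝ) (i : Fin n) : ℝ :=
  ∑ S ∈ (Ni n i).powerset, wgt n S * (ν (insert i S) - ν S)

/-- The positive Shapley value `φ_i⁺ = E[ν(A ∪ {i})]` for `A ∼ P^w`. -/
def phiPlus (n : ℕ) (ν : Finset (Fin n) → ℝ) (i : Fin n) : ℝ :=
  ∑ S ∈ (Ni n i).powerset, wgt n S * ν (insert i S)

/-- The negative Shapley value `φ_i⁻ = E[ν(A)]` for `A ∼ P^w`. -/
def phiMinus (n : ℕ) (ν : Finset (Fin n) → ℝ) (i : Fin n) : ℝ :=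
  ∑ S ∈ (Ni n i).powerset, wgt n S * ν S

/-- The variance `σ_i⁺² = Var[ν(A ∪ {i})]` for `A ∼ P^w`. -/
def sigPlusSq (n : ℕ) (ν : Finset (Fin n) → ℝ) (i : Fin n) : ℝ :=
  ∑ S ∈ (Ni n i).powerset, wgt n S * (ν (insert i S) - phiPlus n ν i) ^ 2

/-- The variance `σ_i⁻² = Var[ν(A)]` for `A ∼ P^w`. -/
def sigMinusSq (n : ℕ) (ν : Finset (Fin n) → ℝ) (i : Fin n) : ℝ :=
  ∑ S ∈ (Ni n i).powerset, wgt n S * (ν S - phiMinus n ν i) ^ 2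

end

noncomputable section

/-- The expectation of `h` under the binomial distribution with `K` trials and success
probability `q`, by recursion on the first trial. -/
def binomExp (q : ℝ) : ℕ → (ℕ → ℝ) → ℝ
  | 0, h => h 0
  | K + 1, h => q * binomExp q K (fun m => h (m + 1)) + (1 - q) * binomExp q K h

theorem binomExp_add (q : ℝ) (K : ℕ) (h₁ h₂ : ℕ → ℝ) :
    binomExp q K (fun m => h₁ m + h₂ m) = binomExp q K h₁ + binomExp q K h₂ := by
  induction K generalizing h₁ h₂ with
  | zero => rfl
  | succ K ih =>
    simp only [binomExp]
    rw [ih, ih]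
    ring

theorem binomExp_one (q : ℝ) (K : ℕ) : binomExp q K (fun _ => 1) = 1 := by
  induction K with
  | zero => rfl
  | succ K ih =>
    simp only [binomExp]
    rw [ih]
    ring

theorem binomExp_mono {q : ℝ} (hq₀ : 0 ≤ q) (hq₁ : q ≤ 1) (K : ℕ) {h₁ h₂ : ℕ → ℝ}
    (h : ∀ m, h₁ m ≤ h₂ m) : binomExp q K h₁ ≤ binomExp q K h₂ := by
  induction K generalizing h₁ h₂ with
  | zero => exact h 0
  | succ K ih =>
    exact add_le_add (mul_le_mul_of_nonneg_left (ih fun m => h (m + 1)) hq₀)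
      (mul_le_mul_of_nonneg_left (ih h) (by linarith))

/-- The size-biasing identity `E[N h(N)] = (K + 1) q E[h(M + 1)]` for `N ∼ Bin(K + 1, q)` and
`M ∼ Bin(K, q)`. -/
theorem binomExp_succ_natCast_mul (q : ℝ) (K : ℕ) (h : ℕ → ℝ) :
    binomExp q (K + 1) (fun m => m * h m)
      = (K + 1) * q * binomExp q K (fun m => h (m + 1)) := by
  induction K generalizing h with
  | zero => simp [binomExp]
  | succ K ih =>
    have hsplit : binomExp q (K + 1) (fun m => ((m + 1 : ℕ) : ℝ) * h (m + 1))
        = binomExp q (K + 1) (fun m => m * h (m + 1))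
          + binomExp q (K + 1) (fun m => h (m + 1)) := by
      rw [← binomExp_add]
      congr 1
      ext m
      push_cast
      ring
    rw [binomExp, hsplit, ih h, ih fun m => h (m + 1)]
    simp only [binomExp]
    push_cast
    ring

theorem binomExp_inv_le {q : ℝ} (hq₀ : 0 < q) (hq₁ : q ≤ 1) (K : ℕ) :
    binomExp q K (fun m => 1 / (1 + (m : ℝ))) ≤ 1 / ((K + 1) * q) := by
  have hid := binomExp_succ_natCast_mul q K fun m => 1 / (m : ℝ)
  have hle : binomExp q (K + 1) (fun m => (m : ℝ) * (1 / (m : ℝ))) ≤ 1 := by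
    refine (binomExp_mono hq₀.le hq₁ _ fun m => ?_).trans_eq (binomExp_one q (K + 1))
    rw [mul_one_div]
    exact div_self_le_one _
  rw [le_div_iff₀ (by positivity)]
  simp only [Nat.cast_add, Nat.cast_one, add_comm _ (1 : ℝ)] at hid hle ⊢
  linarith

section Sampling

variable {α : Type*} [Fintype α] (p : α → ℝ) (D : α → Prop) [DecidablePred D] (f : α → ℝ)

/-- The expectation of `F(N, S)` over `K` i.i.d. samples of weight `p`, where `N` is the number
of samples satisfying `D` and `S` is the sum of `f` over these samples. -/
def iidExp (K : ℕ) (F : ℕ → ℝ → ℝ) : ℝ :=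
  ∑ a : Fin K → α, (∏ k, p (a k)) *
    F (univ.filter fun k => D (a k)).card (∑ k ∈ univ.filter (fun k => D (a k)), f (a k))

theorem iidExp_zero (F : ℕ → ℝ → ℝ) : iidExp p D f 0 F = F 0 0 := by
  simp [iidExp]

theorem iidExp_succ (K : ℕ) (F : ℕ → ℝ → ℝ) :
    iidExp p D f (K + 1) F
      = ∑ x ∈ univ.filter D, p x * iidExp p D f K (fun m s => F (m + 1) (f x + s))
        + ∑ x ∈ univ.filter (fun x => ¬ D x), p x * iidExp p D f K F := by
  simp only [iidExp, card_filter, sum_filter]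
  rw [← sum_add_distrib, ← (Fin.consEquiv fun _ : Fin (K + 1) => α).sum_comp,
    Fintype.sum_prod_type]
  refine sum_congr rfl fun x _ => ?_
  by_cases hx : D x
  · simp [hx, Fin.consEquiv, Fin.sum_univ_succ, Fin.prod_univ_succ, mul_sum, mul_assoc,
      add_comm 1, -sum_boole]
  · simp [hx, Fin.consEquiv, Fin.sum_univ_succ, Fin.prod_univ_succ, mul_sum, mul_assoc,
      -sum_boole]

variable {p D f} {q V : ℝ}

theorem sum_filter_not_eq_one_sub (hp : ∑ x, p x = 1) (hD : ∑ x ∈ univ.filter D, p x = q) :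
    ∑ x ∈ univ.filter (fun x => ¬ D x), p x = 1 - q := by
  have := sum_filter_add_sum_filter_not univ D p
  linarith

theorem iidExp_first_moment (hp : ∑ x, p x = 1) (hD : ∑ x ∈ univ.filter D, p x = q)
    (hf : ∑ x ∈ univ.filter D, p x * f x = 0) (K : ℕ) (c : ℝ) (h : ℕ → ℝ) :
    iidExp p D f K (fun m s => h m * (c + s)) = c * binomExp q K h := by
  induction K generalizing c h with
  | zero => simp [iidExp_zero, binomExp, mul_comm]
  | succ K ih =>
    have hterm : ∀ x, p x * iidExp p D f K (fun m s => h (m + 1) * (c + (f x + s)))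
        = (p x * c + p x * f x) * binomExp q K (fun m => h (m + 1)) := fun x => by
      simp only [← add_assoc]
      rw [ih (c + f x) fun m => h (m + 1)]
      ring
    rw [iidExp_succ, sum_congr rfl fun x _ => hterm x, ← sum_mul, ← sum_mul, sum_add_distrib,
      ← sum_mul, hD, hf, sum_filter_not_eq_one_sub hp hD, ih, binomExp]
    ring

theorem iidExp_second_moment (hp : ∑ x, p x = 1) (hD : ∑ x ∈ univ.filter D, p x = q)
    (hf : ∑ x ∈ univ.filter D, p x * f x = 0)
    (hf₂ : ∑ x ∈ univ.filter D, p x * f x ^ 2 = q * V) (K : ℕ) (c : ℝ) (h : ℕ → ℝ) :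
    iidExp p D f K (fun m s => h m * (c + s) ^ 2)
      = c ^ 2 * binomExp q K h + V * binomExp q K (fun m => m * h m) := by
  induction K generalizing c h with
  | zero => simp [iidExp_zero, binomExp, mul_comm]
  | succ K ih =>
    set B₁ := binomExp q K (fun m => h (m + 1)) with hB₁
    set B₂ := binomExp q K (fun m => m * h (m + 1)) with hB₂
    have hterm : ∀ x, p x * iidExp p D f K (fun m s => h (m + 1) * (c + (f x + s)) ^ 2)
        = p x * (c ^ 2 * B₁ + V * B₂) + p x * f x * (2 * c * B₁) + p x * f x ^ 2 * B₁ :=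
      fun x => by
        simp only [← add_assoc]
        rw [ih (c + f x) fun m => h (m + 1)]
        ring
    have hsplit : binomExp q K (fun m => ((m + 1 : ℕ) : ℝ) * h (m + 1)) = B₂ + B₁ := by
      rw [hB₁, hB₂, ← binomExp_add]
      congr 1
      ext m
      push_cast
      ring
    rw [iidExp_succ, sum_congr rfl fun x _ => hterm x, sum_add_distrib, sum_add_distrib,
      ← sum_mul, ← sum_mul, ← sum_mul, ← sum_mul, hD, hf, hf₂,
      sum_filter_not_eq_one_sub hp hD, ih, binomExp, binomExp, hsplit]
    ring

variable {β : Type*} [Fintype β] {w g : β → ℝ}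

/-- A warm-started average of centered samples is centered. -/
theorem warmMean_first_moment (hg : ∑ b, w b * g b = 0) (hp : ∑ x, p x = 1)
    (hD : ∑ x ∈ univ.filter D, p x = q) (hf : ∑ x ∈ univ.filter D, p x * f x = 0) (K : ℕ) :
    ∑ b, w b * iidExp p D f K (fun m s => (g b + s) / (1 + m)) = 0 := by
  have hterm : ∀ b, w b * iidExp p D f K (fun m s => (g b + s) / (1 + m))
      = w b * g b * binomExp q K (fun m => 1 / (1 + (m : ℝ))) := fun b => by
    rw [mul_assoc, ← iidExp_first_moment hp hD hf]
    simp only [one_div_mul_eq_div]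
  rw [sum_congr rfl fun b _ => hterm b, ← sum_mul, hg, zero_mul]

/-- The second moment of a warm-started average of centered samples of variance `V`, in terms
of the mean reciprocal sample count. -/
theorem warmMean_second_moment (hw : ∑ b, w b = 1) (hg₂ : ∑ b, w b * g b ^ 2 = V)
    (hp : ∑ x, p x = 1) (hD : ∑ x ∈ univ.filter D, p x = q)
    (hf : ∑ x ∈ univ.filter D, p x * f x = 0)
    (hf₂ : ∑ x ∈ univ.filter D, p x * f x ^ 2 = q * V) (K : ℕ) :
    ∑ b, w b * iidExp p D f K (fun m s => ((g b + s) / (1 + m)) ^ 2)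
      = V * binomExp q K (fun m => 1 / (1 + (m : ℝ))) := by
  set h : ℕ → ℝ := fun m => 1 / (1 + (m : ℝ)) ^ 2 with hh
  have hterm : ∀ b, w b * iidExp p D f K (fun m s => ((g b + s) / (1 + m)) ^ 2)
      = w b * g b ^ 2 * binomExp q K h + w b * (V * binomExp q K (fun m => m * h m)) :=
    fun b => by
      rw [mul_assoc, ← mul_add, ← iidExp_second_moment hp hD hf hf₂]
      simp only [hh, one_div_mul_eq_div, div_pow]
  rw [sum_congr rfl fun b _ => hterm b, sum_add_distrib, ← sum_mul, ← sum_mul, hg₂, hw,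
    one_mul, ← mul_add, ← binomExp_add]
  congr 2
  ext m
  have : (1 + (m : ℝ)) ≠ 0 := by positivity
  simp only [hh]
  field_simp

theorem warmMean_second_moment_le (hq₀ : 0 < q) (hq₁ : q ≤ 1) (hV : 0 ≤ V)
    (hw : ∑ b, w b = 1) (hg₂ : ∑ b, w b * g b ^ 2 = V)
    (hp : ∑ x, p x = 1) (hD : ∑ x ∈ univ.filter D, p x = q)
    (hf : ∑ x ∈ univ.filter D, p x * f x = 0)
    (hf₂ : ∑ x ∈ univ.filter D, p x * f x ^ 2 = q * V) {K : ℕ} (hK : 1 ≤ K) :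
    ∑ b, w b * iidExp p D f K (fun m s => ((g b + s) / (1 + m)) ^ 2) ≤ V * (1 / (K * q)) := by
  have hK' : (0 : ℝ) < K := by exact_mod_cast hK
  rw [warmMean_second_moment hw hg₂ hp hD hf hf₂]
  refine mul_le_mul_of_nonneg_left ((binomExp_inv_le hq₀ hq₁ K).trans ?_) hV
  gcongr
  linarith

end Sampling

/-- The second moment of the difference of two independent variables, the first one centered. -/
theorem sum_prod_mul_sub_sq {β γ : Type*} [Fintype β] [Fintype γ] {μ X : β → ℝ} {η Y : γ → ℝ}
    (hμ : ∑ x, μ x = 1) (hη : ∑ y, η y = 1) (hX : ∑ x, μ x * X x = 0) :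
    ∑ x, ∑ y, μ x * η y * (X x - Y y) ^ 2 = ∑ x, μ x * X x ^ 2 + ∑ y, η y * Y y ^ 2 := by
  have hterm : ∀ x, ∑ y, μ x * η y * (X x - Y y) ^ 2
      = μ x * X x ^ 2 - μ x * X x * (2 * ∑ y, η y * Y y) + μ x * ∑ y, η y * Y y ^ 2 :=
    fun x => by
      rw [← mul_one (μ x * X x ^ 2), ← hη]
      simp only [mul_sum]
      rw [← sum_sub_distrib, ← sum_add_distrib]
      exact sum_congr rfl fun y _ => by ring
  rw [sum_congr rfl fun x _ => hterm x, sum_add_distrib, sum_sub_distrib, ← sum_mul, ← sum_mul,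
    hX, hμ]
  ring

theorem one_le_harm {n : ℕ} (hn : 1 ≤ n) : 1 ≤ harm n := by
  obtain ⟨m, rfl⟩ := Nat.exists_eq_add_of_le' hn
  rw [harm, sum_range_succ']
  have : 0 ≤ ∑ k ∈ range m, (1 : ℝ) / ((k + 1 : ℕ) + 1) := sum_nonneg fun k _ => by positivity
  simpa using this

theorem wgt_nonneg (n : ℕ) (S : Finset (Fin n)) : 0 ≤ wgt n S := by
  unfold wgt
  positivity

theorem Pplus_nonneg {n : ℕ} (hn : 1 ≤ n) (S : Finset (Fin n)) : 0 ≤ Pplus n S := by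
  have := one_le_harm hn
  unfold Pplus
  positivity

theorem Pminus_nonneg {n : ℕ} (hn : 1 ≤ n) (S : Finset (Fin n)) : 0 ≤ Pminus n S := by
  have := one_le_harm hn
  have hS : (0 : ℝ) ≤ n - S.card := by
    have := card_le_univ S
    rw [Fintype.card_fin] at this
    rw [sub_nonneg]
    exact_mod_cast this
  unfold Pminus
  positivity

theorem card_Ni {n : ℕ} (i : Fin n) : (Ni n i).card = n - 1 := by
  simp [Ni]

theorem sum_wgt {n : ℕ} (hn : 1 ≤ n) (i : Fin n) : ∑ S ∈ (Ni n i).powerset, wgt n S = 1 := by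
  have hn' : (n : ℝ) ≠ 0 := by exact_mod_cast (by omega : n ≠ 0)
  unfold wgt
  rw [sum_powerset_apply_card (fun s => 1 / ((n : ℝ) * ((n - 1).choose s : ℝ))), card_Ni,
    Nat.sub_add_cancel hn]
  have hterm : ∀ s ∈ range n, (n - 1).choose s • (1 / ((n : ℝ) * ((n - 1).choose s : ℝ)))
      = 1 / n := fun s hs => by
    have : ((n - 1).choose s : ℝ) ≠ 0 := by
      exact_mod_cast (Nat.choose_pos (by rw [mem_range] at hs; omega)).ne'
    rw [nsmul_eq_mul]
    field_simp
  rw [sum_congr rfl hterm]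
  simp [hn']

theorem sum_Pplus {n : ℕ} (hn : 1 ≤ n) : ∑ S, Pplus n S = 1 := by
  have hH : harm n ≠ 0 := by linarith [one_le_harm hn]
  unfold Pplus
  rw [← powerset_univ,
    sum_powerset_apply_card (fun s => 1 / ((s : ℝ) * (n.choose s : ℝ) * harm n)),
    card_univ, Fintype.card_fin, sum_range_succ']
  have hterm : ∀ s ∈ range n,
      n.choose (s + 1) • (1 / (((s + 1 : ℕ) : ℝ) * (n.choose (s + 1) : ℝ) * harm n))
        = 1 / ((s : ℝ) + 1) * (1 / harm n) := fun s hs => by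
    have : (n.choose (s + 1) : ℝ) ≠ 0 := by
      exact_mod_cast (Nat.choose_pos (by rw [mem_range] at hs; omega)).ne'
    have : (s : ℝ) + 1 ≠ 0 := by positivity
    rw [nsmul_eq_mul]
    push_cast
    field_simp
  rw [sum_congr rfl hterm, ← sum_mul, ← harm]
  simp [hH]

theorem Pminus_compl {n : ℕ} (S : Finset (Fin n)) : Pminus n Sᶜ = Pplus n S := by
  have hS : S.card ≤ n := by simpa using card_le_univ S
  unfold Pminus Pplus
  rw [card_compl, Fintype.card_fin, Nat.choose_symm hS, Nat.cast_sub hS, sub_sub_cancel]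

theorem sum_Pminus {n : ℕ} (hn : 1 ≤ n) : ∑ S, Pminus n S = 1 := by
  rw [← sum_Pplus hn, ← Equiv.sum_comp (compl_involutive.toPerm (compl : Finset (Fin n) → _))]
  exact sum_congr rfl fun S _ => Pminus_compl S

theorem notMem_of_mem_powerset_Ni {n : ℕ} {i : Fin n} {S : Finset (Fin n)}
    (hS : S ∈ (Ni n i).powerset) : i ∉ S := fun hi => by
  simpa [Ni] using mem_powerset.1 hS hi

theorem Pplus_insert {n : ℕ} (hn : 1 ≤ n) {i : Fin n} {S : Finset (Fin n)} (hS : i ∉ S) :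
    Pplus n (insert i S) = 1 / harm n * wgt n S := by
  obtain ⟨m, rfl⟩ := Nat.exists_eq_add_of_le' hn
  have hc := Nat.add_one_mul_choose_eq m S.card
  have hc' : ((m + 1 : ℕ) : ℝ) * (m.choose S.card : ℝ)
      = (m + 1).choose (S.card + 1) * ((S.card + 1 : ℕ) : ℝ) := by exact_mod_cast hc
  unfold Pplus wgt
  rw [card_insert_of_notMem hS, Nat.add_sub_cancel, hc', one_div_mul_one_div]
  congr 1
  ring

theorem Pminus_of_notMem {n : ℕ} (hn : 1 ≤ n) {i : Fin n} {S : Finset (Fin n)} (hS : i ∉ S) :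
    Pminus n S = 1 / harm n * wgt n S := by
  obtain ⟨m, rfl⟩ := Nat.exists_eq_add_of_le' hn
  have hle : S.card ≤ m + 1 := by simpa using card_le_univ S
  have hc := Nat.choose_mul_succ_eq m S.card
  have hc' : ((m + 1 : ℕ) : ℝ) * (m.choose S.card : ℝ)
      = (m + 1).choose S.card * (((m + 1 : ℕ) : ℝ) - S.card) := by
    rw [← Nat.cast_sub hle, mul_comm]
    exact_mod_cast hc
  unfold Pminus wgt
  rw [Nat.add_sub_cancel, hc', one_div_mul_one_div]
  congr 1
  ring

theorem filter_notMem_eq_powerset_Ni {n : ℕ} (i : Fin n) :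
    (univ.filter fun S : Finset (Fin n) => i ∉ S) = (Ni n i).powerset := by
  ext S
  simp [Ni, subset_erase]

theorem sum_filter_Pminus {n : ℕ} (hn : 1 ≤ n) (i : Fin n) (F : Finset (Fin n) → ℝ) :
    ∑ S ∈ univ.filter (fun S => i ∉ S), Pminus n S * F S
      = 1 / harm n * ∑ S ∈ (Ni n i).powerset, wgt n S * F S := by
  rw [filter_notMem_eq_powerset_Ni, mul_sum]
  refine sum_congr rfl fun S hS => ?_
  rw [Pminus_of_notMem hn (notMem_of_mem_powerset_Ni hS), mul_assoc]

theorem sum_filter_Pplus {n : ℕ} (hn : 1 ≤ n) (i : Fin n) (F : Finset (Fin n) → ℝ) :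
    ∑ S ∈ univ.filter (fun S => i ∈ S), Pplus n S * F S
      = 1 / harm n * ∑ S ∈ (Ni n i).powerset, wgt n S * F (insert i S) := by
  rw [mul_sum]
  symm
  refine sum_bij' (fun S _ => insert i S) (fun S _ => S.erase i) ?_ ?_ ?_ ?_ ?_
  · simp
  · intro S _
    simpa [Ni] using erase_subset_erase i (subset_univ S)
  · exact fun S hS => erase_insert (notMem_of_mem_powerset_Ni hS)
  · exact fun S hS => insert_erase (mem_filter.1 hS).2
  · intro S hS
    rw [Pplus_insert hn (notMem_of_mem_powerset_Ni hS), mul_assoc]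

/-- The distribution `P^w` on all subsets of the player set, vanishing off the subsets of `N_i`. -/
def warmP (n : ℕ) (i : Fin n) (S : Finset (Fin n)) : ℝ := if S ⊆ Ni n i then wgt n S else 0

theorem warmP_nonneg (n : ℕ) (i : Fin n) (S : Finset (Fin n)) : 0 ≤ warmP n i S := by
  unfold warmP
  split_ifs
  exacts [wgt_nonneg n S, le_rfl]

theorem sum_warmP_mul {n : ℕ} (i : Fin n) (F : Finset (Fin n) → ℝ) :
    ∑ S, warmP n i S * F S = ∑ S ∈ (Ni n i).powerset, wgt n S * F S := by
  have : (Ni n i).powerset = univ.filter fun S => S ⊆ Ni n i := by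
    ext S
    simp
  rw [this, sum_filter]
  refine sum_congr rfl fun S _ => ?_
  unfold warmP
  split_ifs <;> simp

theorem sum_warmP {n : ℕ} (hn : 1 ≤ n) (i : Fin n) : ∑ S, warmP n i S = 1 := by
  simpa [sum_wgt hn i] using sum_warmP_mul i fun _ => (1 : ℝ)

theorem sum_wgt_mul_sub {n : ℕ} (hn : 1 ≤ n) (i : Fin n) (F : Finset (Fin n) → ℝ) :
    ∑ S ∈ (Ni n i).powerset, wgt n S * (F S - ∑ T ∈ (Ni n i).powerset, wgt n T * F T) = 0 := by
  simp only [mul_sub, sum_sub_distrib]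
  rw [← sum_mul, sum_wgt hn, one_mul, sub_self]

theorem jointP_nonneg {n : ℕ} (hn : 1 ≤ n) (K : ℕ) (i : Fin n) (ω : Omega n K) :
    0 ≤ jointP n K i ω :=
  mul_nonneg (mul_nonneg (mul_nonneg (warmP_nonneg n i _) (warmP_nonneg n i _))
    (prod_nonneg fun _ _ => Pplus_nonneg hn _)) (prod_nonneg fun _ _ => Pminus_nonneg hn _)

theorem probEvent_le_expVal_sq {n : ℕ} (hn : 1 ≤ n) (K : ℕ) (i : Fin n) (X : Omega n K → ℝ)
    {ε : ℝ} (hε : 0 < ε) :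
    probEvent n K i (fun ω => ε ≤ |X ω|) ≤ expVal n K i (fun ω => X ω ^ 2) / ε ^ 2 := by
  unfold probEvent expVal
  rw [sum_div]
  refine sum_le_sum fun ω _ => ?_
  have hJ := jointP_nonneg hn K i ω
  split_ifs with h
  · rw [le_div_iff₀ (by positivity)]
    refine mul_le_mul_of_nonneg_left ?_ hJ
    change ε ^ 2 ≤ X ω ^ 2
    rw [← sq_abs (X ω)]
    exact pow_le_pow_left₀ hε.le h 2
  · positivity

theorem sum_warm_prod {α β : Type*} [Fintype α] [Fintype β] {K : ℕ} {w : β → ℝ} {p : α → ℝ}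
    (hw : ∑ b, w b = 1) (hp : ∑ x, p x = 1) :
    ∑ x : β × (Fin K → α), w x.1 * ∏ k, p (x.2 k) = 1 := by
  rw [Fintype.sum_prod_type]
  simp only [← mul_sum]
  rw [← sum_mul, hw, one_mul, ← Fintype.piFinset_univ, sum_prod_piFinset]
  simp [hp]

theorem sum_warm_prod_mul {α β : Type*} [Fintype α] [Fintype β] {K : ℕ} (w : β → ℝ)
    (p : α → ℝ) (D : α → Prop) [DecidablePred D] (f : α → ℝ) (F : β → ℕ → ℝ → ℝ) :
    ∑ x : β × (Fin K → α), (w x.1 * ∏ k, p (x.2 k)) *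
      F x.1 (univ.filter fun k => D (x.2 k)).card
        (∑ k ∈ univ.filter (fun k => D (x.2 k)), f (x.2 k))
      = ∑ b, w b * iidExp p D f K (F b) := by
  rw [Fintype.sum_prod_type]
  simp only [iidExp, mul_sum, mul_assoc]

theorem expVal_sub_sq {n : ℕ} (K : ℕ) (i : Fin n)
    (X Y : Finset (Fin n) × (Fin K → Finset (Fin n)) → ℝ) :
    expVal n K i (fun ω => (X (ω.1, ω.2.2.1) - Y (ω.2.1, ω.2.2.2)) ^ 2)
      = ∑ x : Finset (Fin n) × (Fin K → Finset (Fin n)),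
          ∑ y : Finset (Fin n) × (Fin K → Finset (Fin n)),
            (warmP n i x.1 * ∏ k, Pplus n (x.2 k)) * (warmP n i y.1 * ∏ k, Pminus n (y.2 k)) *
              (X x - Y y) ^ 2 := by
  unfold expVal jointP warmP
  simp only [Fintype.sum_prod_type]
  refine sum_congr rfl fun b _ => ?_
  rw [sum_comm]
  exact sum_congr rfl fun a _ => sum_congr rfl fun b' _ => sum_congr rfl fun a' _ => by ring

/-- The mean of the values, shifted by `c`, of one warm-up sample and the selected main samples. -/
theorem mean_sub {ι : Type*} (s : Finset ι) (u : ι → ℝ) (b c : ℝ) :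
    (b + ∑ k ∈ s, u k) / ((1 + s.card : ℕ) : ℝ) - c
      = ((b - c) + ∑ k ∈ s, (u k - c)) / (1 + s.card) := by
  have : (1 + s.card : ℝ) ≠ 0 := by positivity
  rw [sum_sub_distrib, sum_const, nsmul_eq_mul]
  push_cast
  field_simp
  ring

/-- The average of the warm-up value `g x.1` and the values under `f` of the main samples
satisfying `D`. -/
def warmMean {α β : Type*} {K : ℕ} (g : β → ℝ) (D : α → Prop) [DecidablePred D] (f : α → ℝ)
    (x : β × (Fin K → α)) : ℝ :=
  (g x.1 + ∑ k ∈ univ.filter (fun k => D (x.2 k)), f (x.2 k)) /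
    (1 + (univ.filter fun k => D (x.2 k)).card)

theorem shapley_eq {n : ℕ} (ν : Finset (Fin n) → ℝ) (i : Fin n) :
    shapley n ν i = phiPlus n ν i - phiMinus n ν i := by
  simp only [shapley, phiPlus, phiMinus, mul_sub, sum_sub_distrib]

theorem expVal_phiHat_sub_sq_le {n K : ℕ} (hn : 1 ≤ n) (hK : 1 ≤ K) (ν : Finset (Fin n) → ℝ)
    (i : Fin n) :
    expVal n K i (fun ω => (phiHat n K ν i ω - shapley n ν i) ^ 2)
      ≤ harm n / K * (sigMinusSq n ν i + sigPlusSq n ν i) := by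
  have hH := one_le_harm hn
  have hH₀ : 0 < harm n := by linarith
  have hq₀ : 0 < 1 / harm n := by positivity
  have hq₁ : 1 / harm n ≤ 1 := (div_le_one hH₀).2 hH
  have hK' : (0 : ℝ) < K := by exact_mod_cast hK
  set cp := phiPlus n ν i with hcp
  set cm := phiMinus n ν i with hcm
  have hVp : 0 ≤ sigPlusSq n ν i :=
    sum_nonneg fun S _ => mul_nonneg (wgt_nonneg n S) (sq_nonneg _)
  have hVm : 0 ≤ sigMinusSq n ν i :=
    sum_nonneg fun S _ => mul_nonneg (wgt_nonneg n S) (sq_nonneg _)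
  have hDp : ∑ S ∈ univ.filter (fun S : Finset (Fin n) => i ∈ S), Pplus n S = 1 / harm n := by
    simpa [sum_wgt hn i] using sum_filter_Pplus hn i fun _ => (1 : ℝ)
  have hDm : ∑ S ∈ univ.filter (fun S : Finset (Fin n) => i ∉ S), Pminus n S = 1 / harm n := by
    simpa [sum_wgt hn i] using sum_filter_Pminus hn i fun _ => (1 : ℝ)
  have hzp := sum_wgt_mul_sub hn i fun S => ν (insert i S)
  have hgp : ∑ S, warmP n i S * (ν (insert i S) - cp) = 0 :=
    (sum_warmP_mul i _).trans hzp
  have hfp : ∑ S ∈ univ.filter (fun S => i ∈ S), Pplus n S * (ν S - cp) = 0 := by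
    rw [sum_filter_Pplus hn i fun S => ν S - cp, hcp, phiPlus, hzp, mul_zero]
  have hfm : ∑ S ∈ univ.filter (fun S => i ∉ S), Pminus n S * (ν S - cm) = 0 := by
    rw [sum_filter_Pminus hn i fun S => ν S - cm, hcm, phiMinus, sum_wgt_mul_sub hn i ν,
      mul_zero]
  have hp₂ := warmMean_second_moment_le hq₀ hq₁ hVp (sum_warmP hn i)
    (sum_warmP_mul i fun S => (ν (insert i S) - cp) ^ 2) (sum_Pplus hn) hDp hfp
    (sum_filter_Pplus hn i fun S => (ν S - cp) ^ 2) hK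
  have hm₂ := warmMean_second_moment_le hq₀ hq₁ hVm (sum_warmP hn i)
    (sum_warmP_mul i fun S => (ν S - cm) ^ 2) (sum_Pminus hn) hDm hfm
    (sum_filter_Pminus hn i fun S => (ν S - cm) ^ 2) hK
  have hp₁ := warmMean_first_moment hgp (sum_Pplus hn) hDp hfp K
  rw [← sum_warm_prod_mul] at hp₁ hp₂ hm₂
  set X : Finset (Fin n) × (Fin K → Finset (Fin n)) → ℝ :=
    warmMean (fun S => ν (insert i S) - cp) (fun S => i ∈ S) (fun S => ν S - cp) with hX
  set Y : Finset (Fin n) × (Fin K → Finset (Fin n)) → ℝ :=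
    warmMean (fun S => ν S - cm) (fun S => i ∉ S) (fun S => ν S - cm) with hY
  have herr : (fun ω : Omega n K => (phiHat n K ν i ω - shapley n ν i) ^ 2)
      = fun ω => (X (ω.1, ω.2.2.1) - Y (ω.2.1, ω.2.2.2)) ^ 2 := by
    ext ω
    simp only [hX, hY, warmMean, ← mean_sub, phiHat, phiHatPlus, phiHatMinus, mplus, mminus,
      shapley_eq]
    ring
  rw [herr, expVal_sub_sq, sum_prod_mul_sub_sq (X := X) (Y := Y)
    (sum_warm_prod (sum_warmP hn i) (sum_Pplus hn))
    (sum_warm_prod (sum_warmP hn i) (sum_Pminus hn)) hp₁]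
  refine (add_le_add hp₂ hm₂).trans_eq ?_
  field_simp
  ring

end

/-- Theorem 4.4: with `T̄ = 2K`, for any `ε > 0`,
`P(|φ̂_i − φ_i| ≥ ε) ≤ (2Hₙ/(ε²·T̄))·(σ_i⁻² + σ_i⁺²)`. -/
theorem stmt13 (n K : ℕ) (hn : 1 ≤ n) (hK : 1 ≤ K) (ν : Finset (Fin n) → ℝ)
    (hν : ν ∅ = 0) (i : Fin n) (ε : ℝ) (hε : 0 < ε) :
    probEvent n K i (fun ω => ε ≤ |phiHat n K ν i ω - shapley n ν i|)
      ≤ 2 * harm n / (ε ^ 2 * (2 * (K : ℝ))) * (sigMinusSq n ν i + sigPlusSq n ν i) := by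
  have hK' : (0 : ℝ) < K := by exact_mod_cast hK
  refine (probEvent_le_expVal_sq hn K i _ hε).trans ?_
  rw [div_le_iff₀ (by positivity)]
  refine (expVal_phiHat_sub_sq_le hn hK ν i).trans_eq ?_
  field_simp
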